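/- There exists a context-free capacity-bounded grammar whose language is not context-free. -/

import Mathlib

/-! Common definitions: symbols, context-free grammars, Ginsburg–Spanier phrase
structure grammars, capacity-bounded derivations, matrix/vector grammars,
finite index, cf Petri nets with place capacities, and language families. -/

inductive Symb (N T : Type) where
  | nt : N → Symb N T
  | tm : T → Symb N T
deriving DecidableEq

namespace CapGram

variable {N T Δ α : Type}

open Classical in
/-- Number of occurrences of the nonterminal `A` in a sentential form. -/
noncomputable def symCount (A : N) : List (Symb N T) → ℕ
  | [] => 0
  | Symb.nt B :: r => (if B = A then 1 else 0) + symCount A r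
  | Symb.tm _ :: r => symCount A r

/-- Total number of nonterminal occurrences in a sentential form. -/
def ntCount : List (Symb N T) → ℕ
  | [] => 0
  | Symb.nt _ :: r => 1 + ntCount r
  | Symb.tm _ :: r => ntCount r

/-- The sentential form `w` respects the capacity function `κ`. -/
def CapOK (κ : N → ℕ) (w : List (Symb N T)) : Prop :=
  ∀ A : N, symCount A w ≤ κ A

/-- A context-free grammar (rules are pairs of a nonterminal and a word). -/
structure CFG (N T : Type) where
  start : N
  rules : Finset (N × List (Symb N T))

/-- Application of a single context-free rule. -/
def applyRule (r : N × List (Symb N T)) (u v : List (Symb N T)) : Prop :=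
  ∃ x y : List (Symb N T), u = x ++ Symb.nt r.1 :: y ∧ v = x ++ r.2 ++ y

def CFG.Step (G : CFG N T) (u v : List (Symb N T)) : Prop :=
  ∃ r ∈ G.rules, applyRule r u v

/-- A derivation step both of whose sentential forms respect the capacity. -/
def CFG.CapStep (G : CFG N T) (κ : N → ℕ) (u v : List (Symb N T)) : Prop :=
  G.Step u v ∧ CapOK κ u ∧ CapOK κ v

/-- A derivation step both of whose sentential forms have at most `k`
nonterminal occurrences in total. -/
def CFG.IdxStep (G : CFG N T) (k : ℕ) (u v : List (Symb N T)) : Prop :=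
  G.Step u v ∧ ntCount u ≤ k ∧ ntCount v ≤ k

/-- The (unrestricted) language of a context-free grammar. -/
def CFG.Lang (G : CFG N T) : Set (List T) :=
  { w | Relation.ReflTransGen G.Step [Symb.nt G.start] (w.map Symb.tm) }

/-- The language of the capacity-bounded grammar `(G, κ)`. -/
def CFG.CapLang (G : CFG N T) (κ : N → ℕ) : Set (List T) :=
  { w | Relation.ReflTransGen (G.CapStep κ) [Symb.nt G.start] (w.map Symb.tm) }

/-- Words with a derivation of index at most `k`. -/
def CFG.FinLang (G : CFG N T) (k : ℕ) : Set (List T) :=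
  { w | Relation.ReflTransGen (G.IdxStep k) [Symb.nt G.start] (w.map Symb.tm) }

/-- A phrase structure grammar due to Ginsburg and Spanier: the left-hand side
of a rule is a nonempty word of nonterminals, encoded as head and tail. -/
structure GSG (N T : Type) where
  start : N
  rules : Finset ((N × List N) × List (Symb N T))

def GSG.Step (G : GSG N T) (u v : List (Symb N T)) : Prop :=
  ∃ r ∈ G.rules, ∃ x y : List (Symb N T),
    u = x ++ (r.1.1 :: r.1.2).map Symb.nt ++ y ∧ v = x ++ r.2 ++ y

def GSG.CapStep (G : GSG N T) (κ : N → ℕ) (u v : List (Symb N T)) : Prop :=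
  G.Step u v ∧ CapOK κ u ∧ CapOK κ v

def GSG.Lang (G : GSG N T) : Set (List T) :=
  { w | Relation.ReflTransGen G.Step [Symb.nt G.start] (w.map Symb.tm) }

def GSG.CapLang (G : GSG N T) (κ : N → ℕ) : Set (List T) :=
  { w | Relation.ReflTransGen (G.CapStep κ) [Symb.nt G.start] (w.map Symb.tm) }

/-- Derivations labeled by their sequence of context-free rules, where every
sentential form (including the first and last) satisfies the invariant `P`. -/
inductive DerivP (P : List (Symb N T) → Prop) :
    List (N × List (Symb N T)) → List (Symb N T) → List (Symb N T) → Prop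
  | nil (u : List (Symb N T)) : P u → DerivP P [] u u
  | cons {r π u v w} : P u → applyRule r u v → DerivP P π v w →
      DerivP P (r :: π) u w

/-- A matrix grammar: a finite set of matrices (sequences of cf rules). -/
structure MG (N T : Type) where
  start : N
  mats : Finset (List (N × List (Symb N T)))

/-- Matrix language: rule sequences are concatenations of matrices. -/
def MG.Lang (G : MG N T) : Set (List T) :=
  { w | ∃ ms : List (List (N × List (Symb N T))),
      (∀ m ∈ ms, m ∈ G.mats) ∧
      DerivP (fun _ => True) ms.flatten [Symb.nt G.start] (w.map Symb.tm) }

/-- Words with a matrix derivation of index at most `k`. -/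
def MG.FinLang (G : MG N T) (k : ℕ) : Set (List T) :=
  { w | ∃ ms : List (List (N × List (Symb N T))),
      (∀ m ∈ ms, m ∈ G.mats) ∧
      DerivP (fun u => ntCount u ≤ k) ms.flatten [Symb.nt G.start] (w.map Symb.tm) }

/-- `Shuffle ms π`: `π` is an interleaving (shuffle) of the lists in `ms`. -/
inductive Shuffle : List (List α) → List α → Prop
  | nil (ms : List (List α)) : (∀ l ∈ ms, l = []) → Shuffle ms []
  | cons {ms₁ : List (List α)} {l : List α} {ms₂ : List (List α)} {π : List α}
      (a : α) : Shuffle (ms₁ ++ l :: ms₂) π →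
      Shuffle (ms₁ ++ (a :: l) :: ms₂) (a :: π)

/-- A vector grammar: like a matrix grammar, but derivations use shuffles. -/
structure VG (N T : Type) where
  start : N
  mats : Finset (List (N × List (Symb N T)))

def VG.Lang (G : VG N T) : Set (List T) :=
  { w | ∃ ms π, (∀ m ∈ ms, m ∈ G.mats) ∧ Shuffle ms π ∧
      DerivP (fun _ => True) π [Symb.nt G.start] (w.map Symb.tm) }

def VG.CapLang (G : VG N T) (κ : N → ℕ) : Set (List T) :=
  { w | ∃ ms π, (∀ m ∈ ms, m ∈ G.mats) ∧ Shuffle ms π ∧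
      DerivP (CapOK κ) π [Symb.nt G.start] (w.map Symb.tm) }

def VG.FinLang (G : VG N T) (k : ℕ) : Set (List T) :=
  { w | ∃ ms π, (∀ m ∈ ms, m ∈ G.mats) ∧ Shuffle ms π ∧
      DerivP (fun u => ntCount u ≤ k) π [Symb.nt G.start] (w.map Symb.tm) }

/-! cf Petri nets: places are in bijection with the nonterminals, transitions
with the rules; firing the transition of rule `A → α` consumes one token from
the place of `A` and adds `|α|_X` tokens to the place of each nonterminal `X`. -/

open Classical in
/-- Firing of the transition corresponding to rule `r`, turning marking `μ`
into marking `μ'`. -/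
noncomputable def ruleFire (r : N × List (Symb N T)) (μ μ' : N → ℕ) : Prop :=
  1 ≤ μ r.1 ∧ ∀ A, μ' A = μ A - (if A = r.1 then 1 else 0) + symCount A r.2

/-- Occurrence sequences of the cf Petri net of `G`, all of whose markings
(including initial and final) satisfy the validity predicate `P`. -/
inductive FireSeqP (G : CFG N T) (P : (N → ℕ) → Prop) :
    List (N × List (Symb N T)) → (N → ℕ) → (N → ℕ) → Prop
  | nil (μ : N → ℕ) : P μ → FireSeqP G P [] μ μ
  | cons {r π μ μ' μ''} : r ∈ G.rules → P μ → ruleFire r μ μ' →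
      FireSeqP G P π μ' μ'' → FireSeqP G P (r :: π) μ μ''

open Classical in
/-- The initial marking: one token on the place of the start symbol. -/
noncomputable def initMark (G : CFG N T) : N → ℕ :=
  fun A => if A = G.start then 1 else 0

/-- The language of `G` controlled by its cf Petri net restricted to markings
satisfying `P` (e.g. a place capacity constraint). -/
def CFG.PNLang (G : CFG N T) (P : (N → ℕ) → Prop) : Set (List T) :=
  { w | ∃ π μ, DerivP (fun _ => True) π [Symb.nt G.start] (w.map Symb.tm) ∧
      FireSeqP G P π (initMark G) μ }

/-! Language families over a terminal alphabet `T`. -/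

/-- Context-free languages of finite index. -/
def CFfin (T : Type) : Set (Set (List T)) :=
  { L | ∃ (N : Type) (_ : Fintype N) (G : CFG N T) (k : ℕ),
      L = G.Lang ∧ G.Lang ⊆ G.FinLang k }

/-- Languages of capacity-bounded context-free grammars. -/
def CFcb (T : Type) : Set (Set (List T)) :=
  { L | ∃ (N : Type) (_ : Fintype N) (G : CFG N T) (κ : N → ℕ),
      L = G.CapLang κ }

/-- Languages of capacity-bounded Ginsburg–Spanier phrase structure grammars. -/
def GScb (T : Type) : Set (Set (List T)) :=
  { L | ∃ (N : Type) (_ : Fintype N) (G : GSG N T) (κ : N → ℕ),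
      L = G.CapLang κ }

/-- Matrix languages of finite index. -/
def MATfin (T : Type) : Set (Set (List T)) :=
  { L | ∃ (N : Type) (_ : Fintype N) (G : MG N T) (k : ℕ),
      L = G.Lang ∧ G.Lang ⊆ G.FinLang k }

/-- Capacity-bounded vector languages (erasing rules allowed). -/
def Vcb (T : Type) : Set (Set (List T)) :=
  { L | ∃ (N : Type) (_ : Fintype N) (G : VG N T) (κ : N → ℕ),
      L = G.CapLang κ }

/-- Vector languages of finite index (erasing rules allowed). -/
def Vfin (T : Type) : Set (Set (List T)) :=
  { L | ∃ (N : Type) (_ : Fintype N) (G : VG N T) (k : ℕ),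
      L = G.Lang ∧ G.Lang ⊆ G.FinLang k }

/-- Languages of grammars controlled by cf Petri nets with place capacities. -/
def PNcap (T : Type) : Set (Set (List T)) :=
  { L | ∃ (N : Type) (_ : Fintype N) (G : CFG N T) (κ : N → ℕ),
      L = G.PNLang (fun μ => ∀ A, μ A ≤ κ A) }


/-! ### Contraction in context-free languages -/

/-- `Yields g s w`: the symbols of `s` are the roots of a forest of parse trees of `g` with
frontier `w`. -/
inductive Yields (g : ContextFreeGrammar T) : List (Symbol T g.NT) → List T → Prop
  | nil : Yields g [] []
  | terminal (a : T) {s w} : Yields g s w → Yields g (.terminal a :: s) (a :: w)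
  | nonterminal {r : ContextFreeRule T g.NT} {s w₁ w₂} : r ∈ g.rules → Yields g r.output w₁ →
      Yields g s w₂ → Yields g (.nonterminal r.input :: s) (w₁ ++ w₂)

variable {g : ContextFreeGrammar T}

theorem yields_map_terminal (w : List T) : Yields g (w.map .terminal) w := by
  induction w with
  | nil => exact .nil
  | cons a w ih => exact .terminal a ih

theorem Yields.append {s t : List (Symbol T g.NT)} {w₁ w₂ : List T} (h₁ : Yields g s w₁)
    (h₂ : Yields g t w₂) : Yields g (s ++ t) (w₁ ++ w₂) := by
  induction h₁ with
  | nil => exact h₂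
  | terminal a _ ih => exact .terminal a ih
  | nonterminal hr h _ _ ih => simpa using Yields.nonterminal hr h ih

theorem yields_append {s t : List (Symbol T g.NT)} {w : List T} (h : Yields g (s ++ t) w) :
    ∃ w₁ w₂, w = w₁ ++ w₂ ∧ Yields g s w₁ ∧ Yields g t w₂ := by
  induction s generalizing w with
  | nil => exact ⟨[], w, rfl, .nil, h⟩
  | cons a s ih =>
    cases h with
    | terminal a h =>
      obtain ⟨w₁, w₂, rfl, h₁, h₂⟩ := ih h
      exact ⟨a :: w₁, w₂, rfl, .terminal a h₁, h₂⟩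
    | nonterminal hr h h' =>
      obtain ⟨w₁, w₂, rfl, h₁, h₂⟩ := ih h'
      exact ⟨_, w₂, (List.append_assoc _ _ _).symm, .nonterminal hr h h₁, h₂⟩

theorem Yields.of_derives {s : List (Symbol T g.NT)} {w : List T}
    (h : g.Derives s (w.map .terminal)) : Yields g s w := by
  induction h using Relation.ReflTransGen.head_induction_on with
  | refl => exact yields_map_terminal w
  | head h _ ih =>
    obtain ⟨r, hr, h⟩ := h
    obtain ⟨p, q, rfl, rfl⟩ := h.exists_parts
    obtain ⟨w', w₃, rfl, h', h₃⟩ := yields_append ih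
    obtain ⟨w₁, w₂, rfl, h₁, h₂⟩ := yields_append h'
    have := (h₁.append (.nonterminal hr h₂ .nil)).append h₃
    simpa using this

theorem Yields.derives {s : List (Symbol T g.NT)} {w : List T} (h : Yields g s w) :
    g.Derives s (w.map .terminal) := by
  induction h with
  | nil => rfl
  | terminal a _ ih => exact ih.append_left [.terminal a]
  | @nonterminal r s w₁ w₂ hr _ _ ih₁ ih₂ =>
    have h : g.Produces (.nonterminal r.input :: s) (r.output ++ s) := ⟨r, hr, .head s⟩
    rw [List.map_append]
    exact h.trans_derives ((ih₁.append_right s).trans (ih₂.append_left _))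

/-- `Nested g p q`: in some parse tree with root `p.1` and frontier `p.2`, there is a subtree with
root `q.1` and strictly shorter frontier `q.2`. -/
def Nested (g : ContextFreeGrammar T) (p q : g.NT × List T) : Prop :=
  Yields g [.nonterminal q.1] q.2 ∧ q.2.length < p.2.length ∧ ∃ u z, p.2 = u ++ q.2 ++ z ∧
    g.Derives [.nonterminal p.1] (u.map .terminal ++ [.nonterminal q.1] ++ z.map .terminal)

theorem derives_context_trans {s : List (Symbol T g.NT)} {A B : g.NT} {u z u' z' : List T}
    (h : g.Derives s (u.map .terminal ++ [.nonterminal A] ++ z.map .terminal))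
    (h' : g.Derives [.nonterminal A] (u'.map .terminal ++ [.nonterminal B] ++ z'.map .terminal)) :
    g.Derives s ((u ++ u').map .terminal ++ [.nonterminal B] ++ (z' ++ z).map .terminal) := by
  have := h.trans ((h'.append_left (u.map .terminal)).append_right (z.map .terminal))
  simpa using this

theorem Nested.trans {p q r : g.NT × List T} (h₁ : Nested g p q) (h₂ : Nested g q r) :
    Nested g p r := by
  obtain ⟨-, hl, u, z, hw, hd⟩ := h₁
  obtain ⟨hy, hl', u', z', hw', hd'⟩ := h₂
  exact ⟨hy, hl'.trans hl, u ++ u', z' ++ z, by simp [hw, hw'], derives_context_trans hd hd'⟩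

/-- A long frontier contains the frontier of a subtree whose length is controlled. -/
theorem Yields.exists_subtree {b K : ℕ} (hb : ∀ r ∈ g.rules, r.output.length ≤ b) (hK : 1 ≤ K)
    {s : List (Symbol T g.NT)} {w : List T} (h : Yields g s w) :
    w.length ≤ s.length * K ∨ ∃ B u x z, w = u ++ x ++ z ∧
      g.Derives s (u.map .terminal ++ [.nonterminal B] ++ z.map .terminal) ∧
      Yields g [.nonterminal B] x ∧ K < x.length ∧ x.length ≤ b * K := by
  induction h with
  | nil => simp
  | @terminal a s w _ ih =>
    rcases ih with ih | ⟨B, u, x, z, rfl, hd, hy, h₁, h₂⟩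
    · left
      simp only [List.length_cons, add_mul]
      omega
    · exact .inr ⟨B, a :: u, x, z, rfl, hd.append_left [.terminal a], hy, h₁, h₂⟩
  | @nonterminal r s w₁ w₂ hr hy₁ hy₂ ih₁ ih₂ =>
    have hp : g.Derives [.nonterminal r.input] r.output :=
      ContextFreeGrammar.Produces.single ⟨r, hr, r.rewrites_iff.2 ⟨[], [], by simp, by simp⟩⟩
    have hd₂ := hy₂.derives
    have hroot : g.Derives (.nonterminal r.input :: s)
        (([] : List T).map .terminal ++ [.nonterminal r.input] ++ w₂.map .terminal) :=
      hd₂.append_left [.nonterminal r.input]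
    rcases ih₁ with ih₁ | ⟨B, u, x, z, rfl, hd, hy, h₁, h₂⟩
    · by_cases hw₁ : w₁.length ≤ K
      · rcases ih₂ with ih₂ | ⟨B, u, x, z, rfl, hd, hy, h₁, h₂⟩
        · left
          simp only [List.length_cons, List.length_append, add_mul]
          omega
        · refine .inr ⟨B, w₁ ++ u, x, z, by simp, ?_, hy, h₁, h₂⟩
          have h₃ := (hp.trans hy₁.derives).append_right s
          have h₄ := h₃.trans (hd.append_left (w₁.map .terminal))
          simpa using h₄
      · refine .inr ⟨r.input, [], w₁, w₂, by simp, hroot, ?_, by omega,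
          ih₁.trans (Nat.mul_le_mul_right K (hb r hr))⟩
        simpa using Yields.nonterminal hr hy₁ .nil
    · exact .inr ⟨B, u, x, z ++ w₂, by simp, derives_context_trans hroot (hp.trans hd), hy, h₁, h₂⟩

theorem exists_nested_chain {b : ℕ} (hb : ∀ r ∈ g.rules, r.output.length ≤ b) (hb' : 1 ≤ b)
    (n : ℕ) {A : g.NT} {w : List T} (h : Yields g [.nonterminal A] w) (hw : b ^ n < w.length) :
    ∃ l : List (g.NT × List T), l.length = n ∧ ((A, w) :: l).Pairwise (Nested g) ∧
      ∀ q ∈ l, q.2 ≠ [] := by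
  induction n generalizing A w with
  | zero => exact ⟨[], by simp⟩
  | succ n ih =>
    obtain h' | ⟨B, u, x, z, rfl, hd, hy, h₁, h₂⟩ :=
      h.exists_subtree hb (Nat.one_le_pow n b hb')
    · have := Nat.pow_le_pow_right hb' (Nat.le_add_right n 1)
      simp at h'
      omega
    · obtain ⟨l, hl, hp, hne⟩ := ih hy h₁
      have hn : Nested g (A, u ++ x ++ z) (B, x) :=
        ⟨hy, by rw [pow_succ'] at hw; exact h₂.trans_lt hw, u, z, rfl, hd⟩
      refine ⟨(B, x) :: l, by simp [hl], List.pairwise_cons.2 ⟨fun q hq => ?_, hp⟩,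
        fun q hq => ?_⟩
      · rcases List.mem_cons.1 hq with rfl | hq
        · exact hn
        · exact hn.trans ((List.pairwise_cons.1 hp).1 q hq)
      · rcases List.mem_cons.1 hq with rfl | hq
        · rintro rfl
          simp at h₁
        · exact hne q hq

/-- A pumping lemma, for deletion only, in which the deleted context preserves a given finite
coloring of words. -/
theorem exists_contraction {L : Language T} (hL : L.IsContextFree) {M : Type} [Finite M]
    (c : List T → M) : ∃ n, ∀ w ∈ L, n ≤ w.length → ∃ u v x y z, w = u ++ v ++ x ++ y ++ z ∧
      v ++ y ≠ [] ∧ x ≠ [] ∧ c (v ++ x ++ y) = c x ∧ u ++ x ++ z ∈ L := by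
  classical
  obtain ⟨g, rfl⟩ := hL
  have := Fintype.ofFinite M
  let labels : Finset (g.NT × M) := g.rules.image (·.input) ×ˢ Finset.univ
  let b := g.rules.sup (·.output.length) + 1
  have hb : ∀ r ∈ g.rules, r.output.length ≤ b := fun r hr =>
    (Finset.le_sup (f := (·.output.length)) hr).trans (Nat.le_succ _)
  refine ⟨b ^ (labels.card + 1) + 1, fun w hw hlen => ?_⟩
  obtain ⟨l, hl, hp, hne⟩ := exists_nested_chain hb (Nat.le_add_left 1 _) (labels.card + 1)
    (Yields.of_derives hw) hlen
  obtain ⟨hroot, hp⟩ := List.pairwise_cons.1 hp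
  let label : g.NT × List T → g.NT × M := fun q => (q.1, c q.2)
  have hdup : ¬ (l.map label).Nodup := by
    intro hnd
    have hsub : (l.map label).toFinset ⊆ labels := by
      intro a ha
      obtain ⟨q, hq, rfl⟩ := List.mem_map.1 (List.mem_toFinset.1 ha)
      have hy := (hroot q hq).1
      refine Finset.mem_product.2 ⟨?_, Finset.mem_univ _⟩
      generalize hs : [Symbol.nonterminal q.1] = s, q.2 = x at hy
      cases hy with
      | nil => simp at hs
      | terminal => simp at hs
      | @nonterminal r _ _ _ hr =>
        simp only [List.cons.injEq, Symbol.nonterminal.injEq] at hs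
        exact Finset.mem_image.2 ⟨r, hr, hs.1.symm⟩
    have := Finset.card_le_card hsub
    rw [List.toFinset_card_of_nodup hnd] at this
    simp [hl] at this
  obtain ⟨p, hpl, q, hql, hpq, hlab⟩ : ∃ p ∈ l, ∃ q ∈ l, Nested g p q ∧ label p = label q := by
    by_contra! hcon
    exact hdup (List.pairwise_map.2
      (List.Pairwise.imp_of_mem (fun hp hq h => hcon _ hp _ hq h) hp))
  obtain ⟨-, -, u, z, hw', hd⟩ := hroot p hpl
  obtain ⟨hy, hlt, v, y, hpv, -⟩ := hpq
  simp only [label, Prod.mk.injEq] at hlab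
  refine ⟨u, v, q.2, y, z, by simpa [hpv] using hw', ?_, hne q hql, hpv ▸ hlab.2, ?_⟩
  · intro hvy
    obtain ⟨rfl, rfl⟩ := List.append_eq_nil_iff.1 hvy
    simp [hpv] at hlt
  · rw [hlab.1] at hd
    have := hd.trans ((hy.derives.append_left (u.map .terminal)).append_right (z.map .terminal))
    simpa using this

/-! ### Sentential forms -/

/-- The terminal symbols of a sentential form. -/
def terms : List (Symb N T) → List T
  | [] => []
  | .nt _ :: s => terms s
  | .tm a :: s => a :: terms s

@[simp]
theorem terms_append (s t : List (Symb N T)) : terms (s ++ t) = terms s ++ terms t := by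
  induction s with
  | nil => rfl
  | cons a s ih => cases a <;> simp [terms, ih]

@[simp]
theorem terms_map_tm (w : List T) : terms (w.map (Symb.tm : T → Symb N T)) = w := by
  induction w with
  | nil => rfl
  | cons a w ih => simp [terms, ih]

@[simp]
theorem terms_replicate_tm (n : ℕ) (a : T) :
    terms (List.replicate n (Symb.tm a : Symb N T)) = List.replicate n a := by
  simpa using terms_map_tm (N := N) (List.replicate n a)

@[simp]
theorem symCount_append (A : N) (s t : List (Symb N T)) :
    symCount A (s ++ t) = symCount A s + symCount A t := by
  induction s with
  | nil => simp [symCount]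
  | cons a s ih => cases a <;> simp [symCount, ih, add_assoc]

@[simp]
theorem symCount_replicate_tm (A : N) (n : ℕ) (a : T) :
    symCount A (List.replicate n (Symb.tm a)) = 0 := by
  induction n with
  | zero => rfl
  | succ n ih => simpa [List.replicate_succ, symCount] using ih

section applyRule

variable {r : N × List (Symb N T)}

theorem applyRule.terms_eq {u v : List (Symb N T)} (h : applyRule r u v) :
    ∃ s t, terms u = s ++ t ∧ terms v = s ++ terms r.2 ++ t := by
  obtain ⟨x, y, rfl, rfl⟩ := h
  exact ⟨terms x, terms y, by simp [terms], by simp⟩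

theorem not_applyRule_replicate_tm {n : ℕ} {a : T} {v : List (Symb N T)} :
    ¬ applyRule r (List.replicate n (.tm a)) v := by
  rintro ⟨x, y, h, -⟩
  have : Symb.nt r.1 ∈ List.replicate n (Symb.tm a : Symb N T) := by simp [h]
  simp [List.mem_replicate] at this

theorem not_applyRule_nil {v : List (Symb N T)} : ¬ applyRule r [] v := by
  rintro ⟨x, y, h, -⟩
  simp at h

theorem applyRule_append {p q v : List (Symb N T)} (h : applyRule r (p ++ q) v) :
    (∃ p', applyRule r p p' ∧ v = p' ++ q) ∨ ∃ q', applyRule r q q' ∧ v = p ++ q' := by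
  obtain ⟨x, y, h, rfl⟩ := h
  rcases List.append_eq_append_iff.1 h with ⟨a, rfl, rfl⟩ | ⟨a, rfl, ha⟩
  · exact .inr ⟨a ++ r.2 ++ y, ⟨a, y, rfl, rfl⟩, by simp⟩
  · cases a with
    | nil => exact .inr ⟨r.2 ++ y, ⟨[], y, by simpa using ha.symm, rfl⟩, by simp⟩
    | cons b a =>
      obtain ⟨rfl, rfl⟩ := List.cons.inj ha
      exact .inl ⟨x ++ r.2 ++ a, ⟨x, a, rfl, rfl⟩, by simp⟩

theorem applyRule_singleton {A : N} {v : List (Symb N T)} (h : applyRule r [.nt A] v) :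
    r.1 = A ∧ v = r.2 := by
  obtain ⟨x, y, h, rfl⟩ := h
  cases x with
  | nil => simp_all
  | cons b x => simp at h

theorem applyRule_tm_cons {a : T} {u v : List (Symb N T)} (h : applyRule r (.tm a :: u) v) :
    ∃ u', applyRule r u u' ∧ v = .tm a :: u' := by
  obtain ⟨x, y, h, rfl⟩ := h
  cases x with
  | nil => simp at h
  | cons b x =>
    obtain ⟨rfl, rfl⟩ := List.cons.inj h
    exact ⟨_, ⟨x, y, rfl, rfl⟩, by simp⟩

end applyRule

theorem terms_sublist_of_capSteps {G : CFG N T} {κ : N → ℕ} {u v : List (Symb N T)}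
    (h : Relation.ReflTransGen (G.CapStep κ) u v) : (terms u).Sublist (terms v) := by
  induction h with
  | refl => exact List.Sublist.refl _
  | tail _ h ih =>
    obtain ⟨⟨r, -, h⟩, -⟩ := h
    obtain ⟨s, t, hu, hv⟩ := h.terms_eq
    refine ih.trans ?_
    rw [hu, hv, List.append_assoc]
    exact (List.sublist_append_right _ _).append_left s

/-! ### The grammar -/

/-- Nonterminals of the grammar `syncGrammar`. -/
inductive Var
  | S | X | Y | Z | W
deriving DecidableEq

open Var Symb

instance : Fintype Var := ⟨{S, X, Y, Z, W}, fun A => by cases A <;> simp⟩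

/-- Two threads, started as `X` and `Y`, run through the cycle `X → Y → Z → X`; as no nonterminal
may occur twice, neither can overtake the other. In each round the left thread produces a `0` and
a `2` around itself, and the right thread a `3` and a temporary `W`. The left thread leaves the
cycle for `W` and finishes by the rule producing `1`, the right one by the rule producing `4`. -/
def syncGrammar : CFG Var (Fin 5) where
  start := S
  rules := {(S, [tm 0, nt X, tm 2, tm 3, nt Y]), (X, [nt Y]), (Y, [nt Z]), (Z, [tm 0, nt X, tm 2]),
    (Z, [tm 3, nt W, nt X]), (Z, [nt W]), (W, [tm 1, nt X, nt Y, nt Z]),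
    (Y, [tm 4, nt X, nt Y, nt Z]), (X, []), (Y, []), (Z, []), (W, [])}

/-- Every nonterminal has capacity one. -/
abbrev unitCap : Var → ℕ := fun _ => 1

/-- `i` may precede `j` in a word of the form `0* 1? 2* 3* 4?`. -/
def MayPrecede (i j : Fin 5) : Prop := i < j ∨ i = j ∧ i ≠ 1 ∧ i ≠ 4

instance : DecidableRel MayPrecede := fun _ _ => inferInstanceAs (Decidable (_ ∨ _))

/-- The words of the form `0* 1? 2* 3* 4?`. -/
def Ordered (w : List (Fin 5)) : Prop := w.Pairwise MayPrecede

theorem Ordered.mayPrecede {s t : List (Fin 5)} (h : Ordered (s ++ t)) {i j : Fin 5} (hi : i ∈ s)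
    (hj : j ∈ t) : MayPrecede i j :=
  (List.pairwise_append.1 h).2.2 i hi j hj

/-- The sentential form `0ⁿ g 2ⁿ q`. -/
def frame (n : ℕ) (g q : List (Symb Var (Fin 5))) : List (Symb Var (Fin 5)) :=
  List.replicate n (tm 0) ++ (g ++ (List.replicate n (tm 2) ++ q))

theorem frame_succ (n : ℕ) (g q : List (Symb Var (Fin 5))) :
    frame n (tm 0 :: (g ++ [tm 2])) q = frame (n + 1) g q := by
  have h : List.replicate (n + 1) (tm 0 : Symb Var (Fin 5)) = List.replicate n (tm 0) ++ [tm 0] :=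
    List.replicate_succ'
  rw [frame, frame, h, List.replicate_succ]
  simp

theorem terms_frame (n : ℕ) (g q : List (Symb Var (Fin 5))) : terms (frame n g q) =
    List.replicate n 0 ++ (terms g ++ (List.replicate n 2 ++ terms q)) := by
  simp [frame]

theorem symCount_frame (A : Var) (n : ℕ) (g q : List (Symb Var (Fin 5))) :
    symCount A (frame n g q) = symCount A g + symCount A q := by
  simp [frame]

theorem applyRule_frame {r : Var × List (Symb Var (Fin 5))} {n : ℕ}
    {g q v : List (Symb Var (Fin 5))} (h : applyRule r (frame n g q) v) :
    (∃ g', applyRule r g g' ∧ v = frame n g' q) ∨ ∃ q', applyRule r q q' ∧ v = frame n g q' := by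
  rcases applyRule_append h with ⟨_, h₁, rfl⟩ | ⟨_, h₁, rfl⟩
  · exact absurd h₁ not_applyRule_replicate_tm
  rcases applyRule_append h₁ with ⟨g', h₂, rfl⟩ | ⟨_, h₂, rfl⟩
  · exact .inl ⟨g', h₂, rfl⟩
  rcases applyRule_append h₂ with ⟨_, h₃, rfl⟩ | ⟨q', h₃, rfl⟩
  · exact absurd h₃ not_applyRule_replicate_tm
  · exact .inr ⟨q', h₃, rfl⟩

section Ordered

variable {n : ℕ} {g q : List (Symb Var (Fin 5))} {i : Fin 5}

theorem Ordered.le_two (h : Ordered (terms (frame n g q))) (hn : 1 ≤ n) (hi : i ∈ terms g) :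
    i ≤ 2 := by
  rw [terms_frame, ← List.append_assoc] at h
  have := h.mayPrecede (List.mem_append_right _ hi)
    (List.mem_append_left _ (List.mem_replicate.2 ⟨by omega, rfl⟩))
  clear hi
  revert i
  decide

theorem Ordered.two_le (h : Ordered (terms (frame n g q))) (hn : 1 ≤ n) (hi : i ∈ terms q) :
    2 ≤ i := by
  rw [terms_frame, ← List.append_assoc, ← List.append_assoc] at h
  have := h.mayPrecede (List.mem_append_right _ (List.mem_replicate.2 ⟨by omega, rfl⟩)) hi
  clear hi
  revert i
  decide

end Ordered

/-- The form `l` consists of `m` letters `3` and of some nonterminals `W`. -/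
def RightTrail (m : ℕ) (l : List (Symb Var (Fin 5))) : Prop :=
  terms l = List.replicate m 3 ∧ ∀ A, nt A ∈ l → A = W

theorem RightTrail.step {m : ℕ} {l l' : List (Symb Var (Fin 5))} (h : RightTrail m l)
    {r : Var × List (Symb Var (Fin 5))} (hr : r ∈ syncGrammar.rules) (hl : applyRule r l l') :
    RightTrail m l' ∨ 1 ∈ terms l' := by
  obtain ⟨x, y, rfl, rfl⟩ := hl
  obtain ⟨h₁, h₂⟩ := h
  have hW : r.1 = W := h₂ _ (by simp)
  simp only [syncGrammar, Finset.mem_insert, Finset.mem_singleton] at hr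
  rcases hr with rfl | rfl | rfl | rfl | rfl | rfl | rfl | rfl | rfl | rfl | rfl | rfl <;>
    simp only [reduceCtorEq] at hW
  · right
    simp [terms]
  · left
    refine ⟨by simpa [terms] using h₁, fun A hA => h₂ A ?_⟩
    simp only [List.append_nil, List.mem_append] at hA
    simp only [List.mem_append, List.mem_cons]
    tauto

theorem RightTrail.round {m : ℕ} {l : List (Symb Var (Fin 5))} (h : RightTrail m l) :
    RightTrail (m + 1) (l ++ [tm 3, nt W]) :=
  ⟨by simp [h.1, terms, List.replicate_succ'], fun A hA => by
    rcases List.mem_append.1 hA with hA | hA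
    · exact h.2 A hA
    · simpa using hA⟩

theorem RightTrail.append_W {m : ℕ} {l : List (Symb Var (Fin 5))} (h : RightTrail m l) :
    RightTrail m (l ++ [nt W]) :=
  ⟨by simp [h.1, terms], fun A hA => by
    rcases List.mem_append.1 hA with hA | hA
    · exact h.2 A hA
    · simpa using hA⟩

/-- `Sync s₁ s₂ n m`: the left thread may be at `s₁` after `n` rounds while the right thread is
at `s₂` after `m` rounds. -/
inductive Sync : Var → Var → ℕ → ℕ → Prop
  | xy (n) : Sync X Y n n
  | xz (n) : Sync X Z n n
  | yz (n) : Sync Y Z n n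
  | yx (n) : Sync Y X n (n + 1)
  | zx (n) : Sync Z X n (n + 1)
  | zy (n) : Sync Z Y n (n + 1)
  | wx (n) : Sync W X n (n + 1)
  | wy (n) : Sync W Y n (n + 1)
  | wz (n) : Sync W Z n (n + 1)

/-- An invariant of the derivations of ordered words. The last two cases are those in which a
thread has vanished prematurely. -/
inductive Inv : List (Symb Var (Fin 5)) → Prop
  | start : Inv [nt S]
  | running {n m s₁ s₂ l} : 1 ≤ n → Sync s₁ s₂ n m → RightTrail m l →
      Inv (frame n [nt s₁] (l ++ [nt s₂]))
  | rightDone {n l q} : 1 ≤ n → RightTrail (n + 1) l → terms q = [] →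
      Inv (frame n [nt W] (l ++ tm 4 :: q))
  | bothDone {n l g q} : 1 ≤ n → RightTrail (n + 1) l → terms g = [] → terms q = [] →
      Inv (frame n (tm 1 :: g) (l ++ tm 4 :: q))
  | leftDead {n q} : 1 ≤ n → Inv (frame n [] q)
  | rightDead {n m g l} : 1 ≤ n → RightTrail m l → Inv (frame n g l)

section step

variable {r : Var × List (Symb Var (Fin 5))} {n m : ℕ} {s₁ s₂ : Var}
  {l q v : List (Symb Var (Fin 5))}

theorem Inv.running_left (hr : r ∈ syncGrammar.rules) (hn : 1 ≤ n) (hs : Sync r.1 s₂ n m)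
    (hl : RightTrail m l) (hcap : CapOK unitCap (frame n r.2 (l ++ [nt s₂])))
    (hord : Ordered (terms (frame n r.2 (l ++ [nt s₂])))) :
    Inv (frame n r.2 (l ++ [nt s₂])) := by
  have hle : ∀ i ∈ terms r.2, i ≤ 2 := fun i => hord.le_two hn
  simp only [CapOK, symCount_frame, symCount_append, unitCap] at hcap
  have hX := hcap X
  have hY := hcap Y
  have hZ := hcap Z
  simp only [syncGrammar, Finset.mem_insert, Finset.mem_singleton] at hr
  rcases hr with rfl | rfl | rfl | rfl | rfl | rfl | rfl | rfl | rfl | rfl | rfl | rfl <;>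
    cases hs <;> simp [symCount, terms] at hle hX hY hZ <;>
    first
      | omega
      | exact .leftDead hn
      | exact .running hn (by constructor) hl
      | skip
  change Inv (frame n (tm 0 :: ([nt X] ++ [tm 2])) _)
  rw [frame_succ]
  exact .running (by omega) (.xy _) hl

theorem Inv.running_right (hr : r ∈ syncGrammar.rules) (hn : 1 ≤ n) (hs : Sync s₁ r.1 n m)
    (hl : RightTrail m l) (hcap : CapOK unitCap (frame n [nt s₁] (l ++ r.2)))
    (hord : Ordered (terms (frame n [nt s₁] (l ++ r.2)))) :
    Inv (frame n [nt s₁] (l ++ r.2)) := by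
  have hle : ∀ i ∈ terms r.2, 2 ≤ i := fun i hi => hord.two_le hn (by simp [hi])
  simp only [CapOK, symCount_frame, symCount_append, unitCap] at hcap
  have hX := hcap X
  have hY := hcap Y
  have hZ := hcap Z
  have hW := hcap W
  simp only [syncGrammar, Finset.mem_insert, Finset.mem_singleton] at hr
  rcases hr with rfl | rfl | rfl | rfl | rfl | rfl | rfl | rfl | rfl | rfl | rfl | rfl <;>
    cases hs <;> simp [symCount, terms] at hle hX hY hZ hW <;>
    first
      | omega
      | exact .rightDead hn (by simpa using hl)
      | exact .rightDead hn hl.append_W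
      | exact .running hn (by constructor) hl
      | exact .rightDone hn hl rfl
      | skip
  have := Inv.running hn (.yx n) hl.round
  simpa using this

theorem applyRule_rightDone {l' : List (Symb Var (Fin 5))} {g : List (Symb Var (Fin 5))}
    (hr : r ∈ syncGrammar.rules) (hn : 1 ≤ n)
    (hl : RightTrail m l) (hq : terms q = []) (h : applyRule r (l ++ tm 4 :: q) l')
    (hord : Ordered (terms (frame n g l'))) :
    ∃ l₁ q₁, l' = l₁ ++ tm 4 :: q₁ ∧ RightTrail m l₁ ∧ terms q₁ = [] := by
  rcases applyRule_append h with ⟨l₁, h', rfl⟩ | ⟨q', h', rfl⟩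
  · rcases hl.step hr h' with hl | h1
    · exact ⟨l₁, q, rfl, hl, hq⟩
    · have := hord.two_le hn (i := 1) (by simp [h1])
      exact absurd this (by decide)
  · obtain ⟨q₁, -, rfl⟩ := applyRule_tm_cons h'
    refine ⟨l, q₁, rfl, hl, List.eq_nil_iff_forall_not_mem.2 fun i hi => ?_⟩
    rw [terms_frame, terms_append, terms, ← List.append_assoc, ← List.append_assoc,
      ← List.append_assoc, ← List.singleton_append, ← List.append_assoc] at hord
    have := hord.mayPrecede (List.mem_append_right _ (List.mem_singleton.2 rfl)) hi
    clear hi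
    revert i
    decide

theorem Inv.step {u : List (Symb Var (Fin 5))} (hu : Inv u) (hr : r ∈ syncGrammar.rules)
    (h : applyRule r u v) (hcap : CapOK unitCap v) (hord : Ordered (terms v)) : Inv v := by
  cases hu with
  | start =>
    obtain ⟨hS, rfl⟩ := applyRule_singleton h
    simp only [syncGrammar, Finset.mem_insert, Finset.mem_singleton] at hr
    rcases hr with rfl | rfl | rfl | rfl | rfl | rfl | rfl | rfl | rfl | rfl | rfl | rfl <;>
      simp only [reduceCtorEq] at hS
    exact .running (n := 1) (l := [tm 3]) le_rfl (.xy 1) ⟨rfl, by simp⟩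
  | running hn hs hl =>
    rcases applyRule_frame h with ⟨_, h', rfl⟩ | ⟨_, h', rfl⟩
    · obtain ⟨rfl, rfl⟩ := applyRule_singleton h'
      exact .running_left hr hn hs hl hcap hord
    · rcases applyRule_append h' with ⟨_, h'', rfl⟩ | ⟨_, h'', rfl⟩
      · rcases hl.step hr h'' with hl | h1
        · exact .running hn hs hl
        · have := hord.two_le hn (i := 1) (by simp [h1])
          exact absurd this (by decide)
      · obtain ⟨rfl, rfl⟩ := applyRule_singleton h''
        exact .running_right hr hn hs hl hcap hord
  | rightDone hn hl hq =>
    rcases applyRule_frame h with ⟨_, h', rfl⟩ | ⟨_, h', rfl⟩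
    · obtain ⟨hW, rfl⟩ := applyRule_singleton h'
      simp only [syncGrammar, Finset.mem_insert, Finset.mem_singleton] at hr
      rcases hr with rfl | rfl | rfl | rfl | rfl | rfl | rfl | rfl | rfl | rfl | rfl | rfl <;>
        simp only [reduceCtorEq] at hW
      · exact .bothDone hn hl rfl hq
      · exact .leftDead hn
    · obtain ⟨l₁, q₁, rfl, hl, hq⟩ := applyRule_rightDone hr hn hl hq h' hord
      exact .rightDone hn hl hq
  | @bothDone n l g q hn hl hg hq =>
    rcases applyRule_frame h with ⟨_, h', rfl⟩ | ⟨_, h', rfl⟩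
    · obtain ⟨g', h'', rfl⟩ := applyRule_tm_cons h'
      obtain ⟨s, t, hs, ht⟩ := h''.terms_eq
      obtain ⟨rfl, rfl⟩ := List.append_eq_nil_iff.1 (hs.symm.trans hg)
      have hle : ∀ i ∈ terms r.2, i ≤ 2 := fun i hi => hord.le_two hn (by simp [terms, ht, hi])
      rw [terms_frame, terms, ht, ← List.singleton_append, List.append_assoc,
        ← List.append_assoc] at hord
      have hge : ∀ i ∈ terms r.2, MayPrecede 1 i := fun i hi =>
        hord.mayPrecede (by simp) (by simp [hi])
      refine .bothDone hn hl ?_ hq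
      simp only [ht, List.nil_append, List.append_nil]
      clear hs ht h'' h' h
      simp only [syncGrammar, Finset.mem_insert, Finset.mem_singleton] at hr
      rcases hr with rfl | rfl | rfl | rfl | rfl | rfl | rfl | rfl | rfl | rfl | rfl | rfl <;>
        first
          | rfl
          | exact absurd hle (by decide)
          | exact absurd hge (by decide)
    · obtain ⟨l₁, q₁, rfl, hl, hq⟩ := applyRule_rightDone hr hn hl hq h' hord
      exact .bothDone hn hl hg hq
  | leftDead hn =>
    rcases applyRule_frame h with ⟨_, h', rfl⟩ | ⟨_, h', rfl⟩
    · exact absurd h' not_applyRule_nil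
    · exact .leftDead hn
  | rightDead hn hl =>
    rcases applyRule_frame h with ⟨_, h', rfl⟩ | ⟨_, h', rfl⟩
    · exact .rightDead hn hl
    · rcases hl.step hr h' with hl | h1
      · exact .rightDead hn hl
      · have := hord.two_le hn (i := 1) (by simp [h1])
        exact absurd this (by decide)

end step

theorem RightTrail.eq_three {m : ℕ} {l : List (Symb Var (Fin 5))} (h : RightTrail m l) {i : Fin 5}
    (hi : i ∈ terms l) : i = 3 := by
  rw [h.1] at hi
  exact (List.mem_replicate.1 hi).2

theorem Inv.count_eq {w : List (Fin 5)} (h : Inv (w.map tm)) (hord : Ordered w) (h1 : 1 ∈ w)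
    (h4 : 4 ∈ w) : w.count 0 = w.count 2 ∧ w.count 3 = w.count 0 + 1 := by
  have hnt : ∀ A, nt A ∉ (w.map tm : List (Symb Var (Fin 5))) := by simp
  have hterms : terms (w.map tm : List (Symb Var (Fin 5))) = w := terms_map_tm w
  generalize (w.map tm : List (Symb Var (Fin 5))) = u at h hnt hterms
  subst hterms
  cases h with
  | start => simp at hnt
  | @running _ _ s₁ => exact absurd (by simp [frame]) (hnt s₁)
  | rightDone => exact absurd (by simp [frame]) (hnt W)
  | bothDone hn hl hg hq =>
    simp [terms_frame, terms, hl.1, hg, hq, List.count_replicate]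
  | @leftDead n q hn =>
    have h1' : (1 : Fin 5) ∈ terms q := by simpa [terms_frame, terms, List.mem_replicate] using h1
    exact absurd (hord.two_le hn h1') (by decide)
  | rightDead hn hl =>
    rw [terms_frame, List.mem_append, List.mem_append, List.mem_append] at h4
    rcases h4 with h4 | h4 | h4 | h4
    · simp [List.mem_replicate] at h4
    · exact absurd (hord.le_two hn h4) (by decide)
    · simp [List.mem_replicate] at h4
    · exact absurd (hl.eq_three h4) (by decide)

theorem count_eq_of_mem_capLang {w : List (Fin 5)} (h : w ∈ syncGrammar.CapLang unitCap)
    (hord : Ordered w) (h1 : 1 ∈ w) (h4 : 4 ∈ w) :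
    w.count 0 = w.count 2 ∧ w.count 3 = w.count 0 + 1 := by
  suffices Inv (w.map tm) from this.count_eq hord h1 h4
  have key : ∀ u : List (Symb Var (Fin 5)),
      Relation.ReflTransGen (syncGrammar.CapStep unitCap) u (w.map tm) → Inv u →
      Inv (w.map tm) := by
    intro u hu
    induction hu using Relation.ReflTransGen.head_induction_on with
    | refl => exact id
    | head h h' ih =>
      obtain ⟨⟨r, hr, h⟩, -, hcap⟩ := h
      have hs := terms_sublist_of_capSteps h'
      rw [terms_map_tm] at hs
      exact fun hu => ih (hu.step hr h hcap (hord.sublist hs))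
  exact key _ h .start

/-- The sentential form `0ⁿ g 2ⁿ 3ᵐ q`. -/
def roundForm (n m : ℕ) (g q : List (Symb Var (Fin 5))) : List (Symb Var (Fin 5)) :=
  frame n g (List.replicate m (tm 3) ++ q)

/-- The number of occurrences of any nonterminal in `g` and `q` together is at most one. -/
def FitsUnitCap (g q : List (Symb Var (Fin 5))) : Prop :=
  ∀ A, symCount A g + symCount A q ≤ 1

theorem capOK_roundForm {n m : ℕ} {g q : List (Symb Var (Fin 5))} (h : FitsUnitCap g q) :
    CapOK unitCap (roundForm n m g q) := by
  intro A
  simpa [roundForm, symCount_frame] using h A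

section derivation

variable {A : Var} {s : List (Symb Var (Fin 5))} {n m : ℕ}

theorem capStep_left (h : (A, s) ∈ syncGrammar.rules) (g₁ g₂ q : List (Symb Var (Fin 5)))
    (h₁ : FitsUnitCap (g₁ ++ nt A :: g₂) q) (h₂ : FitsUnitCap (g₁ ++ s ++ g₂) q) :
    syncGrammar.CapStep unitCap (roundForm n m (g₁ ++ nt A :: g₂) q)
      (roundForm n m (g₁ ++ s ++ g₂) q) :=
  ⟨⟨_, h, List.replicate n (tm 0) ++ g₁,
    g₂ ++ (List.replicate n (tm 2) ++ (List.replicate m (tm 3) ++ q)),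
    by simp [roundForm, frame], by simp [roundForm, frame]⟩, capOK_roundForm h₁, capOK_roundForm h₂⟩

theorem capStep_right (h : (A, s) ∈ syncGrammar.rules) (g q₁ q₂ : List (Symb Var (Fin 5)))
    (h₁ : FitsUnitCap g (q₁ ++ nt A :: q₂)) (h₂ : FitsUnitCap g (q₁ ++ s ++ q₂)) :
    syncGrammar.CapStep unitCap (roundForm n m g (q₁ ++ nt A :: q₂))
      (roundForm n m g (q₁ ++ s ++ q₂)) :=
  ⟨⟨_, h, List.replicate n (tm 0) ++ (g ++ (List.replicate n (tm 2) ++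
      (List.replicate m (tm 3) ++ q₁))), q₂,
    by simp [roundForm, frame], by simp [roundForm, frame]⟩, capOK_roundForm h₁, capOK_roundForm h₂⟩

end derivation

theorem roundForm_succ_left (n m : ℕ) (g q : List (Symb Var (Fin 5))) :
    roundForm n m (tm 0 :: (g ++ [tm 2])) q = roundForm (n + 1) m g q :=
  frame_succ n g _

theorem roundForm_succ_right (n m : ℕ) (g q : List (Symb Var (Fin 5))) :
    roundForm n m g (tm 3 :: q) = roundForm n (m + 1) g q := by
  simp [roundForm, List.replicate_succ']

theorem fitsUnitCap_iff {g q : List (Symb Var (Fin 5))} : FitsUnitCap g q ↔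
    symCount S g + symCount S q ≤ 1 ∧ symCount X g + symCount X q ≤ 1 ∧
      symCount Y g + symCount Y q ≤ 1 ∧ symCount Z g + symCount Z q ≤ 1 ∧
      symCount W g + symCount W q ≤ 1 := by
  refine ⟨fun h => ⟨h S, h X, h Y, h Z, h W⟩, ?_⟩
  rintro ⟨hS, hX, hY, hZ, hW⟩ (_ | _) <;> assumption

theorem derives_half_round (n : ℕ) :
    Relation.ReflTransGen (syncGrammar.CapStep unitCap) (roundForm n n [nt X] [nt Y])
      (roundForm n (n + 1) [nt Z] [nt Y]) := by
  refine .head (capStep_right (A := Y) (s := [nt Z]) ?_ [nt X] [] [] ?_ ?_) ?_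
  rotate_left 3
  refine .head (capStep_left (A := X) (s := [nt Y]) ?_ [] [] [nt Z] ?_ ?_) ?_
  rotate_left 3
  refine .head (capStep_right (A := Z) (s := [tm 3, nt W, nt X]) ?_ [nt Y] [] [] ?_ ?_) ?_
  rotate_left 3
  refine .head (capStep_right (A := W) (s := []) ?_ [nt Y] [tm 3] [nt X] ?_ ?_) ?_
  rotate_left 3
  refine .head (capStep_left (A := Y) (s := [nt Z]) ?_ [] [] [tm 3, nt X] ?_ ?_) ?_
  rotate_left 3
  refine .head (capStep_right (A := X) (s := [nt Y]) ?_ [nt Z] [tm 3] [] ?_ ?_) ?_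
  rotate_left 3
  · exact roundForm_succ_right n n _ _ ▸ .refl
  all_goals simp [syncGrammar, fitsUnitCap_iff, symCount]

theorem derives_roundForm {n : ℕ} (hn : 1 ≤ n) :
    Relation.ReflTransGen (syncGrammar.CapStep unitCap) [nt S] (roundForm n n [nt X] [nt Y]) := by
  induction n, hn using Nat.le_induction with
  | base =>
    refine .single ⟨⟨(S, [tm 0, nt X, tm 2, tm 3, nt Y]), by simp [syncGrammar], [], [], rfl, rfl⟩,
      fun A => ?_, fun A => ?_⟩ <;> cases A <;> simp [symCount, roundForm, frame]
  | succ n hn ih =>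
    refine (ih.trans (derives_half_round n)).tail ?_
    rw [← roundForm_succ_left]
    refine capStep_left (A := Z) (s := [tm 0, nt X, tm 2]) ?_ [] [] [nt Y] ?_ ?_ <;>
      simp [syncGrammar, fitsUnitCap_iff, symCount]

/-- The word `0ⁿ 1 2ⁿ 3ⁿ⁺¹ 4`. -/
def syncWord (n : ℕ) : List (Fin 5) :=
  List.replicate n 0 ++ 1 :: (List.replicate n 2 ++ (List.replicate (n + 1) 3 ++ [4]))

theorem derives_finish (n : ℕ) :
    Relation.ReflTransGen (syncGrammar.CapStep unitCap) (roundForm n (n + 1) [nt Z] [nt Y])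
      ((syncWord n).map tm) := by
  refine .head (capStep_left (A := Z) (s := [nt W]) ?_ [] [] [nt Y] ?_ ?_) ?_
  rotate_left 3
  refine .head (capStep_right (A := Y) (s := [tm 4, nt X, nt Y, nt Z]) ?_ [nt W] [] [] ?_ ?_) ?_
  rotate_left 3
  refine .head (capStep_right (A := X) (s := []) ?_ [nt W] [tm 4] [nt Y, nt Z] ?_ ?_) ?_
  rotate_left 3
  refine .head (capStep_right (A := Y) (s := []) ?_ [nt W] [tm 4] [nt Z] ?_ ?_) ?_
  rotate_left 3
  refine .head (capStep_right (A := Z) (s := []) ?_ [nt W] [tm 4] [] ?_ ?_) ?_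
  rotate_left 3
  refine .head (capStep_left (A := W) (s := [tm 1, nt X, nt Y, nt Z]) ?_ [] [] [tm 4] ?_ ?_) ?_
  rotate_left 3
  refine .head (capStep_left (A := X) (s := []) ?_ [tm 1] [nt Y, nt Z] [tm 4] ?_ ?_) ?_
  rotate_left 3
  refine .head (capStep_left (A := Y) (s := []) ?_ [tm 1] [nt Z] [tm 4] ?_ ?_) ?_
  rotate_left 3
  refine .head (capStep_left (A := Z) (s := []) ?_ [tm 1] [] [tm 4] ?_ ?_) ?_
  rotate_left 3
  · simp [roundForm, frame, syncWord, Relation.ReflTransGen.refl]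
  all_goals simp [syncGrammar, fitsUnitCap_iff, symCount]

theorem syncWord_mem_capLang {n : ℕ} (hn : 1 ≤ n) :
    syncWord n ∈ syncGrammar.CapLang unitCap :=
  (derives_roundForm hn).trans ((derives_half_round n).trans (derives_finish n))

theorem ordered_syncWord (n : ℕ) : Ordered (syncWord n) := by
  simp only [Ordered, syncWord, List.pairwise_append, List.pairwise_cons, List.mem_append,
    List.mem_cons, List.mem_replicate, List.pairwise_replicate, MayPrecede]
  grind

theorem MayPrecede.antisymm {i j : Fin 5} (h : MayPrecede i j) (h' : MayPrecede j i) : i = j := by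
  revert i j
  decide

theorem Ordered.eq_replicate_of_head?_eq {v x y : List (Fin 5)} (h : Ordered (v ++ x ++ y))
    (hx : x ≠ []) (hhead : (v ++ x ++ y).head? = x.head?) :
    ∃ n t, MayPrecede t t ∧ v = List.replicate n t := by
  obtain ⟨t, x, rfl⟩ := List.exists_cons_of_ne_nil hx
  cases v with
  | nil => exact ⟨0, 0, by decide, rfl⟩
  | cons s v =>
    obtain rfl : s = t := by simpa using hhead
    have hs : ∀ j ∈ s :: v, MayPrecede j s := fun j hj =>
      mayPrecede (s := s :: v) (t := s :: x) (List.pairwise_append.1 h).1 hj (by simp)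
    refine ⟨_, s, hs s (by simp), List.eq_replicate_length.2 fun j hj => ?_⟩
    rcases List.mem_cons.1 hj with rfl | hj'
    · rfl
    · exact (hs j hj).antisymm ((List.pairwise_cons.1 h).1 j (by simp [hj']))

theorem Ordered.eq_replicate_of_getLast?_eq {v x y : List (Fin 5)} (h : Ordered (v ++ x ++ y))
    (hx : x ≠ []) (hlast : (v ++ x ++ y).getLast? = x.getLast?) :
    ∃ n t, MayPrecede t t ∧ y = List.replicate n t := by
  rcases List.eq_nil_or_concat' x with rfl | ⟨x, t, rfl⟩
  · exact absurd rfl hx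
  rcases List.eq_nil_or_concat' y with rfl | ⟨y, s, rfl⟩
  · exact ⟨0, 0, by decide, rfl⟩
  obtain rfl : s = t := by simpa [← List.append_assoc] using hlast
  have hs : ∀ j ∈ y ++ [s], MayPrecede s j := fun j hj => h.mayPrecede (by simp) hj
  refine ⟨_, s, hs s (by simp), List.eq_replicate_length.2 fun j hj => ?_⟩
  rcases List.mem_append.1 hj with hj' | hj'
  · exact ((hs j hj).antisymm
      (mayPrecede (List.pairwise_append.1 h).2.1 hj' (List.mem_singleton.2 rfl))).symm
  · exact List.mem_singleton.1 hj'

theorem not_isContextFree_syncGrammar :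
    ¬ Language.IsContextFree (syncGrammar.CapLang unitCap) := by
  intro hcf
  obtain ⟨p, hp⟩ := exists_contraction hcf fun w : List (Fin 5) => (w.head?, w.getLast?)
  have hord := ordered_syncWord (p + 1)
  have hmem := syncWord_mem_capLang (Nat.le_add_left 1 p)
  have h1 : (1 : Fin 5) ∈ syncWord (p + 1) := by simp [syncWord]
  have h4 : (4 : Fin 5) ∈ syncWord (p + 1) := by simp [syncWord]
  obtain ⟨u, v, x, y, z, hw, hvy, hx, hc, hmem'⟩ :=
    hp _ hmem (by simp only [syncWord, List.length_append, List.length_replicate]; omega)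
  rw [hw] at hord hmem h1 h4
  have hmid : Ordered (v ++ x ++ y) := hord.sublist
    (List.IsInfix.sublist ⟨u, z, by simp⟩)
  obtain ⟨a, s, hs, rfl⟩ := hmid.eq_replicate_of_head?_eq hx (Prod.ext_iff.1 hc).1
  obtain ⟨b, t, ht, rfl⟩ := hmid.eq_replicate_of_getLast?_eq hx (Prod.ext_iff.1 hc).2
  have hord' : Ordered (u ++ x ++ z) := hord.sublist <| by
    simp only [List.append_assoc]
    exact ((List.Sublist.append_left (List.sublist_append_right _ _) _).trans
      (List.sublist_append_right _ _)).append_left _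
  have key : ∀ i, ¬ MayPrecede i i → i ∈ u ++ List.replicate a s ++ x ++ List.replicate b t ++ z →
      i ∈ u ++ x ++ z := by
    intro i hi h
    have his : i ≠ s := fun h => hi (h ▸ hs)
    have hit : i ≠ t := fun h => hi (h ▸ ht)
    simp only [List.mem_append, List.mem_replicate, his, hit, and_false, or_false] at h ⊢
    exact h
  have hcount := count_eq_of_mem_capLang hmem hord h1 h4
  have hcount' := count_eq_of_mem_capLang hmem' hord' (key 1 (by decide) h1) (key 4 (by decide) h4)
  simp only [List.count_append, List.count_replicate] at hcount hcount'
  have hab : a = 0 ∧ b = 0 := by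
    clear key hmid hord hord' hc hp hw hmem hmem' h1 h4 hvy
    fin_cases s <;> first | exact absurd hs (by decide) | skip
    all_goals fin_cases t <;> first | exact absurd ht (by decide) | skip
    all_goals simp at hcount; omega
  simp [hab.1, hab.2] at hvy

/-- there is a capacity-bounded context-free grammar whose
language is not context-free. -/
theorem exists_capacity_bounded_not_context_free :
    ∃ (T N : Type) (_ : Fintype N) (G : CFG N T) (κ : N → ℕ),
      ¬ Language.IsContextFree (G.CapLang κ) := by
  exact ⟨Fin 5, Var, inferInstance, syncGrammar, unitCap, not_isContextFree_syncGrammar⟩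

end CapGram
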